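/- Let n ≥ 6 and let Σ_n = (K_n, σ) be a doubly signed complete graph whose triangles realize all four elements of F as double signs. Then for every g ∈ F there exists a Hamiltonian circle of Σ_n with double sign g. -/

import Mathlib

/-- The Klein four-group, written additively. -/
abbrev F : Type := ZMod 2 × ZMod 2

/-- The double sign of the triangle spanned by three vertices. -/
def triSign {n : ℕ} (σ : Sym2 (Fin n) → F) (a b c : Fin n) : F :=
  σ s(a, b) + σ s(b, c) + σ s(a, c)

/-- The double sign of a walk: the sum of the labels of its edges. -/
def walkSign {n : ℕ} (σ : Sym2 (Fin n) → F) {u v : Fin n}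
    (w : (⊤ : SimpleGraph (Fin n)).Walk u v) : F :=
  (w.edges.map σ).sum

section Walks

variable {V : Type*}

/-- The sum of the labels of consecutive entries of a list. -/
def pathSum (τ : V → V → F) : List V → F
  | a :: b :: l => τ a b + pathSum τ (b :: l)
  | _ => 0

theorem pathSum_append (τ : V → V → F) (v : V) (r : List V) :
    ∀ l : List V, pathSum τ (l ++ v :: r) = pathSum τ (l ++ [v]) + pathSum τ (v :: r)
  | [] => by simp [pathSum]
  | [a] => by simp [pathSum]
  | a :: b :: l => by
    have := pathSum_append τ v r (b :: l)
    simp only [List.cons_append, pathSum] at this ⊢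
    rw [this, add_assoc]

theorem F.add_self (x : F) : x + x = 0 := by decide +revert

theorem pathSum_switch (τ : V → V → F) (s : V → F) (v : V) :
    ∀ (l : List V) (u : V), pathSum (fun i j => τ i j + s i + s j) (u :: (l ++ [v])) =
      pathSum τ (u :: (l ++ [v])) + s u + s v
  | [], u => by simp [pathSum]
  | a :: l, u => by
    have := pathSum_switch τ s v l a
    simp only [List.cons_append, pathSum] at this ⊢
    rw [this]
    linear_combination F.add_self (s a)

theorem exists_walk {n : ℕ} (σ : Sym2 (Fin n) → F) :
    ∀ (l : List (Fin n)) (a : Fin n), (a :: l).Nodup →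
      ∃ (b : Fin n) (w : (⊤ : SimpleGraph (Fin n)).Walk a b), w.support = a :: l ∧
        ∀ x, walkSign σ w + σ s(b, x) = pathSum (fun i j => σ s(i, j)) (a :: (l ++ [x]))
  | [], a, _ => ⟨a, .nil, by simp, by simp [walkSign, pathSum]⟩
  | c :: l, a, h => by
    obtain ⟨b, w, hw, hs⟩ := exists_walk σ l c h.of_cons
    have hac : (⊤ : SimpleGraph (Fin n)).Adj a c := by
      rw [SimpleGraph.top_adj]
      rintro rfl
      simp at h
    refine ⟨b, .cons hac w, by simp [hw], fun x => ?_⟩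
    simp only [List.cons_append, pathSum, ← hs x]
    simp [walkSign, add_assoc]

/-- A cyclic order of all the vertices is traversed by a Hamiltonian cycle. -/
theorem exists_isHamiltonianCycle {n : ℕ} (hn : 3 ≤ n) (σ : Sym2 (Fin n) → F)
    (a : Fin n) (l : List (Fin n)) (hl : (a :: l).Nodup) (hmem : ∀ x, x ∈ a :: l) :
    ∃ (v : Fin n) (w : (⊤ : SimpleGraph (Fin n)).Walk v v), w.IsHamiltonianCycle ∧
      walkSign σ w = pathSum (fun i j => σ s(i, j)) (a :: (l ++ [a])) := by
  obtain ⟨b, w, hw, hs⟩ := exists_walk σ l a hl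
  have hp : w.IsPath := by rw [SimpleGraph.Walk.isPath_def, hw]; exact hl
  have hlen : w.length + 1 = n := by
    have h1 := w.length_support
    have h2 : (a :: l).toFinset = Finset.univ := by
      ext x; simpa using hmem x
    have h3 := List.toFinset_card_of_nodup hl
    rw [h2, Finset.card_univ, Fintype.card_fin, ← hw] at h3
    omega
  have hba : (⊤ : SimpleGraph (Fin n)).Adj b a := by
    rw [SimpleGraph.top_adj]
    rintro rfl
    have := (SimpleGraph.Walk.isPath_iff_nil.1 hp).length_eq_zero
    omega
  refine ⟨b, .cons hba w, ?_, ?_⟩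
  · rw [SimpleGraph.Walk.isHamiltonianCycle_iff_isCycle_and_length_eq,
      SimpleGraph.Walk.cons_isCycle_iff]
    refine ⟨⟨hp, fun he => ?_⟩, by simp [hlen]⟩
    rw [Sym2.eq_swap] at he
    have := hp.length_eq_one_of_mem_edges he
    omega
  · rw [← hs a]
    simp [walkSign, add_comm]

end Walks

section Spans

variable {V : Type*}

/-- Some two vertices of the list `S` are joined by paths of all double signs that run through
all of `S`. -/
def Spans (τ : V → V → F) (S : List V) : Prop :=
  ∃ (u v : V) (l₀ : List V), (u :: (l₀ ++ [v])).Perm S ∧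
    ∀ g, ∃ l : List V, l.Perm l₀ ∧ pathSum τ (u :: (l ++ [v])) = g

theorem Spans.of_switch {τ : V → V → F} {S : List V} (s : V → F)
    (h : Spans (fun i j => τ i j + s i + s j) S) : Spans τ S := by
  obtain ⟨u, v, l₀, hl₀, H⟩ := h
  refine ⟨u, v, l₀, hl₀, fun g => ?_⟩
  obtain ⟨l, hl, hg⟩ := H (g + s u + s v)
  rw [pathSum_switch] at hg
  exact ⟨l, hl, by simpa using hg⟩

theorem Spans.cons_vertex {τ : V → V → F} {S : List V} (h : Spans τ S) (e : V) :
    Spans τ (e :: S) := by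
  obtain ⟨u, v, l₀, hl₀, H⟩ := h
  refine ⟨u, e, l₀ ++ [v], ?_, fun g => ?_⟩
  · exact (List.perm_append_comm (l₁ := u :: (l₀ ++ [v])) (l₂ := [e])).trans (hl₀.cons e)
  · obtain ⟨l, hl, hg⟩ := H (g + τ v e)
    refine ⟨l ++ [v], hl.append_right _, ?_⟩
    have := pathSum_append τ v [e] (u :: l)
    simp only [List.cons_append, pathSum] at this hg
    simp only [List.append_assoc, List.cons_append, List.nil_append]
    rw [this, hg]
    linear_combination F.add_self (τ v e)

theorem Spans.perm {τ : V → V → F} {S S' : List V} (h : Spans τ S) (hS : S.Perm S') :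
    Spans τ S' := by
  obtain ⟨u, v, l₀, hl₀, H⟩ := h
  exact ⟨u, v, l₀, hl₀.trans hS, H⟩

theorem Spans.exists_isHamiltonianCycle {n : ℕ} (hn : 3 ≤ n) {σ : Sym2 (Fin n) → F}
    {S : List (Fin n)} (hS : S.Nodup) (h : Spans (fun i j => σ s(i, j)) S) (g : F) :
    ∃ (v : Fin n) (w : (⊤ : SimpleGraph (Fin n)).Walk v v),
      w.IsHamiltonianCycle ∧ walkSign σ w = g := by
  obtain ⟨u, v, l₀, hl₀, H⟩ := h
  set r := (Finset.univ.filter (· ∉ S)).toList with hr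
  obtain ⟨l, hl, hg⟩ := H (g + pathSum (fun i j => σ s(i, j)) (v :: (r ++ [u])))
  have hp : (u :: (l ++ v :: r)).Perm (S ++ r) := by
    have h1 : (u :: (l ++ [v])).Perm S := ((hl.append_right _).cons u).trans hl₀
    simpa using h1.append_right r
  obtain ⟨x, w, hw, hs⟩ := _root_.exists_isHamiltonianCycle hn σ u (l ++ v :: r)
    (by
      rw [hp.nodup_iff, List.nodup_append]
      refine ⟨hS, Finset.nodup_toList _, fun a ha b hb => ?_⟩
      rintro rfl
      simp [hr, ha] at hb)
    (fun x => by rw [hp.mem_iff]; by_cases hx : x ∈ S <;> simp [hr, hx])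
  refine ⟨x, w, hw, ?_⟩
  have := pathSum_append (fun i j => σ s(i, j)) v (r ++ [u]) (u :: l)
  simp only [List.cons_append, List.append_assoc] at this hs ⊢
  rw [hs, this, hg, add_assoc, F.add_self, add_zero]

end Spans

section Masks

/-- The numbers `0, 1, 2, 3` encode the elements of `F`; addition becomes `Nat.xor`. -/
def enc (x : F) : ℕ := 2 * x.1.val + x.2.val

theorem enc_zero : enc 0 = 0 := rfl

theorem enc_add (x y : F) : enc (x + y) = Nat.xor (enc x) (enc y) := by decide +revert

theorem enc_injective : Function.Injective enc := by decide

theorem enc_lt (x : F) : enc x < 4 := by decide +revert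

/-- A bit mask that contains the codes of all four elements of `F`. -/
def isFull (m : ℕ) : Bool := m.testBit 0 && m.testBit 1 && m.testBit 2 && m.testBit 3

theorem isFull_iff (m : ℕ) : isFull m = true ↔ ∀ g, m.testBit (enc g) = true := by
  have h (g : F) : g = (0, 0) ∨ g = (0, 1) ∨ g = (1, 0) ∨ g = (1, 1) := by decide +revert
  have h0 : enc (0, 0) = 0 := rfl
  have h1 : enc (0, 1) = 1 := rfl
  have h2 : enc (1, 0) = 2 := rfl
  have h3 : enc (1, 1) = 3 := rfl
  simp only [isFull, Bool.and_eq_true]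
  constructor
  · rintro ⟨⟨⟨h₀, h₁⟩, h₂⟩, h₃⟩ g
    obtain rfl | rfl | rfl | rfl := h g <;> simp_all
  · intro H
    exact ⟨⟨⟨h0 ▸ H _, h1 ▸ H _⟩, h2 ▸ H _⟩, h3 ▸ H _⟩

theorem testBit_lor {m k i : ℕ} :
    (Nat.lor m k).testBit i = true ↔ m.testBit i = true ∨ k.testBit i = true := by
  change (m ||| k).testBit i = true ↔ _
  simp

theorem testBit_shiftLeft_enc {x g : F} :
    (Nat.shiftLeft 1 (enc x)).testBit (enc g) = true ↔ x = g := by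
  rw [Nat.shiftLeft_eq', Nat.one_shiftLeft, Nat.testBit_two_pow, decide_eq_true_iff,
    enc_injective.eq_iff]

/-! `pathMask₁`, …, `pathMask₄` collect the codes of the double signs, shifted by `acc`, of the
paths between two vertices `u` and `v` through one, …, four further vertices `a`, `b`, `c`, `d`,
given the codes of the edges. -/

/-- Codes of the paths from `u` to `v` through `a`. -/
def pathMask₁ (acc ua va : ℕ) : ℕ := Nat.shiftLeft 1 (Nat.xor (Nat.xor acc ua) va)

/-- Codes of the paths from `u` to `v` through `a` and `b`. -/
def pathMask₂ (acc ua ub va vb ab : ℕ) : ℕ :=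
  Nat.lor (pathMask₁ (Nat.xor acc ua) ab vb) (pathMask₁ (Nat.xor acc ub) ab va)

/-- Codes of the paths from `u` to `v` through `a`, `b` and `c`. -/
def pathMask₃ (acc ua ub uc va vb vc ab ac bc : ℕ) : ℕ :=
  Nat.lor (pathMask₂ (Nat.xor acc ua) ab ac vb vc bc)
    (Nat.lor (pathMask₂ (Nat.xor acc ub) ab bc va vc ac)
      (pathMask₂ (Nat.xor acc uc) ac bc va vb ab))

/-- Codes of the paths from `u` to `v` through `a`, `b`, `c` and `d`. -/
def pathMask₄ (acc ua ub uc ud va vb vc vd ab ac ad bc bd cd : ℕ) : ℕ :=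
  Nat.lor
    (Nat.lor (pathMask₃ (Nat.xor acc ua) ab ac ad vb vc vd bc bd cd)
      (pathMask₃ (Nat.xor acc ub) ab bc bd va vc vd ac ad cd))
    (Nat.lor (pathMask₃ (Nat.xor acc uc) ac bc cd va vb vd ab ad bd)
      (pathMask₃ (Nat.xor acc ud) ad bd cd va vb vc ab ac bc))

variable {V : Type*} {τ : V → V → F}

theorem exists_path_cons {acc g : F} {u a v : V} {l₀ S : List V} (hS : (a :: l₀).Perm S)
    (h : ∃ l : List V, l.Perm l₀ ∧ acc + τ u a + pathSum τ (a :: (l ++ [v])) = g) :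
    ∃ l : List V, l.Perm S ∧ acc + pathSum τ (u :: (l ++ [v])) = g := by
  obtain ⟨l, hl, hg⟩ := h
  exact ⟨a :: l, (hl.cons a).trans hS, by simpa [pathSum, add_assoc] using hg⟩

theorem exists_path_of_pathMask₁ (hτ : ∀ x y, τ x y = τ y x) {acc g : F} {u v a : V}
    (h : (pathMask₁ (enc acc) (enc (τ u a)) (enc (τ v a))).testBit (enc g) = true) :
    ∃ l : List V, l.Perm [a] ∧ acc + pathSum τ (u :: (l ++ [v])) = g := by
  rw [pathMask₁, ← enc_add, ← enc_add, testBit_shiftLeft_enc] at h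
  exact ⟨[a], .refl _, by simpa [pathSum, add_assoc, hτ a v] using h⟩

theorem exists_path_of_pathMask₂ (hτ : ∀ x y, τ x y = τ y x) {acc g : F} {u v a b : V}
    (h : (pathMask₂ (enc acc) (enc (τ u a)) (enc (τ u b)) (enc (τ v a)) (enc (τ v b))
      (enc (τ a b))).testBit (enc g) = true) :
    ∃ l : List V, l.Perm [a, b] ∧ acc + pathSum τ (u :: (l ++ [v])) = g := by
  simp only [pathMask₂, ← enc_add, testBit_lor] at h
  rcases h with h | h
  · exact exists_path_cons (.refl _) (exists_path_of_pathMask₁ hτ h)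
  · rw [hτ a b] at h
    exact exists_path_cons (.swap _ _ _) (exists_path_of_pathMask₁ hτ h)

theorem exists_path_of_pathMask₃ (hτ : ∀ x y, τ x y = τ y x) {acc g : F} {u v a b c : V}
    (h : (pathMask₃ (enc acc) (enc (τ u a)) (enc (τ u b)) (enc (τ u c)) (enc (τ v a))
      (enc (τ v b)) (enc (τ v c)) (enc (τ a b)) (enc (τ a c)) (enc (τ b c))).testBit
      (enc g) = true) :
    ∃ l : List V, l.Perm [a, b, c] ∧ acc + pathSum τ (u :: (l ++ [v])) = g := by
  simp only [pathMask₃, ← enc_add, testBit_lor] at h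
  rcases h with h | h | h
  · exact exists_path_cons (.refl _) (exists_path_of_pathMask₂ hτ h)
  · rw [hτ a b] at h
    exact exists_path_cons (.swap _ _ _) (exists_path_of_pathMask₂ hτ h)
  · rw [hτ a c, hτ b c] at h
    exact exists_path_cons (List.perm_append_comm (l₁ := [c]) (l₂ := [a, b]))
      (exists_path_of_pathMask₂ hτ h)

theorem exists_path_of_pathMask₄ (hτ : ∀ x y, τ x y = τ y x) {acc g : F} {u v a b c d : V}
    (h : (pathMask₄ (enc acc) (enc (τ u a)) (enc (τ u b)) (enc (τ u c)) (enc (τ u d))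
      (enc (τ v a)) (enc (τ v b)) (enc (τ v c)) (enc (τ v d)) (enc (τ a b)) (enc (τ a c))
      (enc (τ a d)) (enc (τ b c)) (enc (τ b d)) (enc (τ c d))).testBit (enc g) = true) :
    ∃ l : List V, l.Perm [a, b, c, d] ∧ acc + pathSum τ (u :: (l ++ [v])) = g := by
  simp only [pathMask₄, ← enc_add, testBit_lor] at h
  rcases h with (h | h) | (h | h)
  · exact exists_path_cons (.refl _) (exists_path_of_pathMask₃ hτ h)
  · rw [hτ a b] at h
    exact exists_path_cons (.swap _ _ _) (exists_path_of_pathMask₃ hτ h)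
  · rw [hτ a c, hτ b c] at h
    exact exists_path_cons ((List.perm_append_comm (l₁ := [c]) (l₂ := [a, b])).append_right [d])
      (exists_path_of_pathMask₃ hτ h)
  · rw [hτ a d, hτ b d, hτ c d] at h
    exact exists_path_cons (List.perm_append_comm (l₁ := [d]) (l₂ := [a, b, c]))
      (exists_path_of_pathMask₃ hτ h)

theorem Spans.of_pathMask₃ (hτ : ∀ x y, τ x y = τ y x) (u v a b c : V) {S : List V}
    (hS : [u, a, b, c, v].Perm S)
    (h : isFull (pathMask₃ 0 (enc (τ u a)) (enc (τ u b)) (enc (τ u c)) (enc (τ v a))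
      (enc (τ v b)) (enc (τ v c)) (enc (τ a b)) (enc (τ a c)) (enc (τ b c))) = true) :
    Spans τ S := by
  refine ⟨u, v, [a, b, c], hS, fun g => ?_⟩
  simpa using exists_path_of_pathMask₃ hτ (acc := 0) ((isFull_iff _).1 h g)

theorem Spans.of_pathMask₄ (hτ : ∀ x y, τ x y = τ y x) (u v a b c d : V) {S : List V}
    (hS : [u, a, b, c, d, v].Perm S)
    (h : isFull (pathMask₄ 0 (enc (τ u a)) (enc (τ u b)) (enc (τ u c)) (enc (τ u d))
      (enc (τ v a)) (enc (τ v b)) (enc (τ v c)) (enc (τ v d)) (enc (τ a b)) (enc (τ a c))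
      (enc (τ a d)) (enc (τ b c)) (enc (τ b d)) (enc (τ c d))) = true) :
    Spans τ S := by
  refine ⟨u, v, [a, b, c, d], hS, fun g => ?_⟩
  simpa using exists_path_of_pathMask₄ hτ (acc := 0) ((isFull_iff _).1 h g)

end Masks

section SixVertices

/-- Whether the vertices `z`, `a`, `b`, `c`, `d` are spanned by paths along an edge of the
circle `zabcd`, when all edges at `z` have label zero. -/
def spans₅ (ab ac bc ad bd cd : ℕ) : Bool :=
  isFull (pathMask₃ 0 0 0 0 ab ac ad bc bd cd) || (isFull (pathMask₃ 0 0 ac ad 0 bc bd 0 0 cd) ||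
  (isFull (pathMask₃ 0 0 ab bd 0 ac cd 0 0 ad) || (isFull (pathMask₃ 0 0 ac bc 0 ad bd 0 0 ab) ||
  isFull (pathMask₃ 0 0 0 0 ad bd cd ab ac bc))))

/-- Whether the vertices `z`, `a`, `b`, `c`, `d`, `e` are spanned by paths along one of the edges
`za`, `ab`, `bc`, when all edges at `z` have label zero. -/
def spans₆ (ab ac bc ad bd cd ae be ce de : ℕ) : Bool :=
  isFull (pathMask₄ 0 0 0 0 0 ab ac ad ae bc bd be cd ce de) ||
  (isFull (pathMask₄ 0 0 ac ad ae 0 bc bd be 0 0 0 cd ce de) ||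
  isFull (pathMask₄ 0 0 ab bd be 0 ac cd ce 0 0 0 ad ae de))

/-- The code of a triangle, as a bit mask. -/
def triMask (x y z : ℕ) : ℕ := Nat.shiftLeft 1 (Nat.xor (Nat.xor x y) z)

/-- Codes of all triangles on `z`, `a`, `b`, `c`, `d`, `e`, when all edges at `z` have label
zero. -/
def triMask₆ (ab ac bc ad bd cd ae be ce de : ℕ) : ℕ :=
  [triMask 0 ab 0, triMask 0 ac 0, triMask 0 ad 0, triMask 0 ae 0, triMask 0 bc 0,
   triMask 0 bd 0, triMask 0 be 0, triMask 0 cd 0, triMask 0 ce 0, triMask 0 de 0,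
   triMask ab bc ac, triMask ab bd ad, triMask ab be ae, triMask ac cd ad, triMask ac ce ae,
   triMask ad de ae, triMask bc cd bd, triMask bc ce be, triMask bd de be,
   triMask cd de ce].foldr Nat.lor 0

/-- Quantification over the codes of `F`. -/
def allCodes (p : ℕ → Bool) : Bool := p 0 && p 1 && p 2 && p 3

theorem allCodes_enc {p : ℕ → Bool} (h : allCodes p = true) (x : F) : p (enc x) = true := by
  have hx := enc_lt x
  simp only [allCodes, Bool.and_eq_true] at h
  obtain ⟨⟨⟨h0, h1⟩, h2⟩, h3⟩ := h
  interval_cases enc x <;> assumption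

theorem spans_of_isFull_triMask₆ :
    (allCodes fun ab => allCodes fun ac => allCodes fun bc =>
      allCodes fun ad => allCodes fun bd => allCodes fun cd =>
      spans₅ ab ac bc ad bd cd ||
      allCodes fun ae => allCodes fun be => allCodes fun ce =>
      spans₅ ab ac bc ae be ce ||
      allCodes fun de =>
      spans₅ ab ad bd ae be de || (spans₅ ac ad cd ae ce de || (spans₅ bc bd cd be ce de ||
      (!isFull (triMask₆ ab ac bc ad bd cd ae be ce de) ||
        spans₆ ab ac bc ad bd cd ae be ce de)))) = true := by
  decide +kernel

variable {V : Type*} {τ : V → V → F}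

theorem Spans.of_spans₅ (hτ : ∀ x y, τ x y = τ y x) {z a b c d : V}
    (ha : τ z a = 0) (hb : τ z b = 0) (hc : τ z c = 0) (hd : τ z d = 0)
    (h : spans₅ (enc (τ a b)) (enc (τ a c)) (enc (τ b c)) (enc (τ a d)) (enc (τ b d))
      (enc (τ c d)) = true) :
    Spans τ [z, a, b, c, d] := by
  have ha' := hτ a z ▸ ha
  have hb' := hτ b z ▸ hb
  have hc' := hτ c z ▸ hc
  have hd' := hτ d z ▸ hd
  simp only [spans₅, Bool.or_eq_true] at h
  rcases h with h | h | h | h | h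
  · refine .of_pathMask₃ hτ z a b c d ?_ ?_
    · exact (List.perm_append_comm (l₁ := [b, c, d]) (l₂ := [a])).cons z
    · simpa only [ha, hb, hc, hd, enc_zero] using h
  · refine .of_pathMask₃ hτ a b z c d ?_ ?_
    · exact ((List.Perm.swap z a _).trans
        (((List.perm_append_comm (l₁ := [c, d]) (l₂ := [b])).cons a).cons z))
    · simpa only [ha', hb', hc, hd, enc_zero] using h
  · refine .of_pathMask₃ hτ b c z a d ?_ ?_
    · refine (List.Perm.swap z b _).trans (.cons z ?_)
      exact (List.Perm.swap a b _).trans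
        (((List.perm_append_comm (l₁ := [d]) (l₂ := [c])).cons b).cons a)
    · simpa only [ha, hb', hc', hd, enc_zero, hτ b a, hτ c a] using h
  · refine .of_pathMask₃ hτ c d z a b ?_ ?_
    · refine (List.Perm.swap z c _).trans (.cons z ?_)
      exact (List.perm_append_comm (l₁ := [c]) (l₂ := [a, b])).append_right [d]
    · simpa only [ha, hb, hc', hd', enc_zero, hτ c a, hτ c b, hτ d a, hτ d b] using h
  · refine .of_pathMask₃ hτ z d a b c (.refl _) ?_
    simpa only [ha, hb, hc, hd, enc_zero, hτ d a, hτ d b, hτ d c] using h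

theorem Spans.of_spans₆ (hτ : ∀ x y, τ x y = τ y x) {z a b c d e : V}
    (ha : τ z a = 0) (hb : τ z b = 0) (hc : τ z c = 0) (hd : τ z d = 0) (he : τ z e = 0)
    (h : spans₆ (enc (τ a b)) (enc (τ a c)) (enc (τ b c)) (enc (τ a d)) (enc (τ b d))
      (enc (τ c d)) (enc (τ a e)) (enc (τ b e)) (enc (τ c e)) (enc (τ d e)) = true) :
    Spans τ [z, a, b, c, d, e] := by
  have ha' := hτ a z ▸ ha
  have hb' := hτ b z ▸ hb
  have hc' := hτ c z ▸ hc
  simp only [spans₆, Bool.or_eq_true] at h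
  rcases h with h | h | h
  · refine .of_pathMask₄ hτ z a b c d e ?_ ?_
    · exact (List.perm_append_comm (l₁ := [b, c, d, e]) (l₂ := [a])).cons z
    · simpa only [ha, hb, hc, hd, he, enc_zero] using h
  · refine .of_pathMask₄ hτ a b z c d e ?_ ?_
    · exact (List.Perm.swap z a _).trans
        (((List.perm_append_comm (l₁ := [c, d, e]) (l₂ := [b])).cons a).cons z)
    · simpa only [ha', hb', hc, hd, he, enc_zero] using h
  · refine .of_pathMask₄ hτ b c z a d e ?_ ?_
    · refine (List.Perm.swap z b _).trans (.cons z ?_)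
      exact (List.Perm.swap a b _).trans
        (((List.perm_append_comm (l₁ := [d, e]) (l₂ := [c])).cons b).cons a)
    · simpa only [ha, hb', hc', hd, he, enc_zero, hτ b a, hτ c a] using h

/-- The sum of the labels of a triangle. -/
def triSum (τ : V → V → F) (a b c : V) : F := τ a b + τ b c + τ a c

theorem triSum_switch (s : V → F) (a b c : V) :
    triSum (fun i j => τ i j + s i + s j) a b c = triSum τ a b c := by
  simp only [triSum]
  linear_combination F.add_self (s a) + F.add_self (s b) + F.add_self (s c)

theorem triSum_swap_left (hτ : ∀ x y, τ x y = τ y x) (a b c : V) :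
    triSum τ b a c = triSum τ a b c := by
  simp only [triSum, hτ b a]
  abel

theorem triSum_swap_right (hτ : ∀ x y, τ x y = τ y x) (a b c : V) :
    triSum τ a c b = triSum τ a b c := by
  simp only [triSum, hτ c b]
  abel

theorem triSum_add (a b c d : V) :
    triSum τ a b c + triSum τ a b d + triSum τ a c d + triSum τ b c d = 0 := by
  simp only [triSum]
  linear_combination F.add_self (τ a b) + F.add_self (τ a c) + F.add_self (τ a d) +
    F.add_self (τ b c) + F.add_self (τ b d) + F.add_self (τ c d)

theorem exists_sorted_triSum (hτ : ∀ x y, τ x y = τ y x) {m : ℕ} (f : Fin m → V) {i j k : Fin m}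
    (hij : i ≠ j) (hik : i ≠ k) (hjk : j ≠ k) :
    ∃ i' j' k', i' < j' ∧ j' < k' ∧
      triSum τ (f i') (f j') (f k') = triSum τ (f i) (f j) (f k) := by
  have hl := triSum_swap_left hτ
  have hr := triSum_swap_right hτ
  rcases lt_or_gt_of_ne hij with h₁ | h₁ <;> rcases lt_or_gt_of_ne hik with h₂ | h₂ <;>
    rcases lt_or_gt_of_ne hjk with h₃ | h₃
  · exact ⟨i, j, k, h₁, h₃, rfl⟩
  · exact ⟨i, k, j, h₂, h₃, hr _ _ _⟩
  · exact absurd (h₁.trans h₃) h₂.asymm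
  · exact ⟨k, i, j, h₂, h₁, by rw [hl, hr]⟩
  · exact ⟨j, i, k, h₁, h₂, hl _ _ _⟩
  · exact absurd (h₁.trans h₂) h₃.asymm
  · exact ⟨j, k, i, h₃, h₂, by rw [hr, hl]⟩
  · exact ⟨k, j, i, h₃, h₁, by rw [hl, hr, hl]⟩

theorem testBit_triMask {x y z g : F} :
    (triMask (enc x) (enc y) (enc z)).testBit (enc g) = true ↔ x + y + z = g := by
  rw [triMask, ← enc_add, ← enc_add, testBit_shiftLeft_enc]

theorem testBit_triMask_zero {x g : F} :
    (triMask 0 (enc x) 0).testBit (enc g) = true ↔ x = g := by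
  rw [← enc_zero, testBit_triMask, zero_add, add_zero]

theorem isFull_triMask₆ (hτ : ∀ x y, τ x y = τ y x) {z a b c d e : V}
    (ha : τ z a = 0) (hb : τ z b = 0) (hc : τ z c = 0) (hd : τ z d = 0) (he : τ z e = 0)
    (h : ∀ g, ∃ x ∈ [z, a, b, c, d, e], ∃ y ∈ [z, a, b, c, d, e], ∃ w ∈ [z, a, b, c, d, e],
      x ≠ y ∧ x ≠ w ∧ y ≠ w ∧ triSum τ x y w = g) :
    isFull (triMask₆ (enc (τ a b)) (enc (τ a c)) (enc (τ b c)) (enc (τ a d)) (enc (τ b d))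
      (enc (τ c d)) (enc (τ a e)) (enc (τ b e)) (enc (τ c e)) (enc (τ d e))) = true := by
  rw [isFull_iff]
  intro g
  obtain ⟨x, hx, y, hy, w, hw, hxy, hxw, hyw, hg⟩ := h g
  obtain ⟨i, rfl⟩ := List.mem_iff_get.1 hx
  obtain ⟨j, rfl⟩ := List.mem_iff_get.1 hy
  obtain ⟨k, rfl⟩ := List.mem_iff_get.1 hw
  obtain ⟨i', j', k', hij, hjk, hg'⟩ := exists_sorted_triSum hτ [z, a, b, c, d, e].get
    (fun h => hxy (congrArg _ h)) (fun h => hxw (congrArg _ h)) (fun h => hyw (congrArg _ h))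
  rw [hg] at hg'
  clear h hx hy hw hxy hxw hyw hg
  have key : ∀ i j k : Fin 6, i < j → j < k → (i, j, k) ∈
      ([(0, 1, 2), (0, 1, 3), (0, 1, 4), (0, 1, 5), (0, 2, 3), (0, 2, 4), (0, 2, 5), (0, 3, 4),
        (0, 3, 5), (0, 4, 5), (1, 2, 3), (1, 2, 4), (1, 2, 5), (1, 3, 4), (1, 3, 5), (1, 4, 5),
        (2, 3, 4), (2, 3, 5), (2, 4, 5), (3, 4, 5)] : List (Fin 6 × Fin 6 × Fin 6)) := by
    decide
  simp only [triMask₆, List.foldr, testBit_lor, testBit_triMask, testBit_triMask_zero]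
  have hmem := key i' j' k' hij hjk
  simp only [List.mem_cons, Prod.mk.injEq, List.not_mem_nil, or_false] at hmem
  rcases hmem with h | h | h | h | h | h | h | h | h | h | h | h | h | h | h | h | h | h | h | h <;>
  · obtain ⟨rfl, rfl, rfl⟩ := h
    subst hg'
    simp [triSum, ha, hb, hc, hd, he]

/-- Six vertices whose triangles have all four double signs are spanned. -/
theorem Spans.of_triSum (hτ : ∀ x y, τ x y = τ y x) {z a b c d e : V}
    (hS : [z, a, b, c, d, e].Nodup)
    (h : ∀ g, ∃ x ∈ [z, a, b, c, d, e], ∃ y ∈ [z, a, b, c, d, e], ∃ w ∈ [z, a, b, c, d, e],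
      x ≠ y ∧ x ≠ w ∧ y ≠ w ∧ triSum τ x y w = g) :
    Spans τ [z, a, b, c, d, e] := by
  classical
  set s : V → F := fun i => if i = z then 0 else τ z i with hs
  refine .of_switch s ?_
  have hz : ∀ x, x ≠ z → τ z x + s z + s x = 0 := by
    intro x hx
    simp [hs, hx, F.add_self]
  have hsum : triSum τ = triSum (fun i j => τ i j + s i + s j) := by
    funext x y w
    rw [triSum_switch]
  rw [hsum] at h
  have hτ' : ∀ x y, τ x y + s x + s y = τ y x + s y + s x := by
    intro x y
    rw [hτ x y]
    abel
  generalize hρ : (fun i j => τ i j + s i + s j) = ρ at h ⊢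
  have hρz : ∀ x, x ≠ z → ρ z x = 0 := hρ ▸ hz
  have hρc : ∀ x y, ρ x y = ρ y x := hρ ▸ hτ'
  have hne : a ≠ z ∧ b ≠ z ∧ c ≠ z ∧ d ≠ z ∧ e ≠ z := by
    simp only [List.nodup_cons, List.mem_cons, not_or] at hS
    grind
  have ha := hρz a hne.1
  have hb := hρz b hne.2.1
  have hc := hρz c hne.2.2.1
  have hd := hρz d hne.2.2.2.1
  have he := hρz e hne.2.2.2.2
  have hm := isFull_triMask₆ hρc ha hb hc hd he h
  have H := allCodes_enc (allCodes_enc (allCodes_enc (allCodes_enc (allCodes_enc (allCodes_enc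
    spans_of_isFull_triMask₆ (ρ a b)) (ρ a c)) (ρ b c)) (ρ a d)) (ρ b d)) (ρ c d)
  rw [Bool.or_eq_true] at H
  rcases H with H | H
  · exact ((Spans.of_spans₅ hρc ha hb hc hd H).cons_vertex e).perm
      (List.perm_append_comm (l₁ := [e]) (l₂ := [z, a, b, c, d]))
  replace H := allCodes_enc (allCodes_enc (allCodes_enc H (ρ a e)) (ρ b e)) (ρ c e)
  rw [Bool.or_eq_true] at H
  rcases H with H | H
  · exact ((Spans.of_spans₅ hρc ha hb hc he H).cons_vertex d).perm
      ((List.perm_append_comm (l₁ := [d]) (l₂ := [z, a, b, c])).append_right [e])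
  replace H := allCodes_enc H (ρ d e)
  simp only [Bool.or_eq_true, hm, Bool.not_true, Bool.false_eq_true, false_or] at H
  rcases H with H | H | H | H
  · exact ((Spans.of_spans₅ hρc ha hb hd he H).cons_vertex c).perm
      ((List.perm_append_comm (l₁ := [c]) (l₂ := [z, a, b])).append_right [d, e])
  · exact ((Spans.of_spans₅ hρc ha hc hd he H).cons_vertex b).perm
      ((List.perm_append_comm (l₁ := [b]) (l₂ := [z, a])).append_right [c, d, e])
  · exact ((Spans.of_spans₅ hρc hb hc hd he H).cons_vertex a).perm (.swap _ _ _)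
  · exact Spans.of_spans₆ hρc ha hb hc hd he H

end SixVertices

section Reduction

variable {V : Type*}

/-- The triples of distinct elements of `W` take all values in `F`. -/
def RealizesAll (T : V → V → V → F) (W : Finset V) : Prop :=
  ∀ g, ∃ x ∈ W, ∃ y ∈ W, ∃ w ∈ W, x ≠ y ∧ x ≠ w ∧ y ≠ w ∧ T x y w = g

theorem RealizesAll.mono {T : V → V → V → F} {W W' : Finset V} (h : RealizesAll T W)
    (hW : W ⊆ W') : RealizesAll T W' := fun g =>
  let ⟨x, hx, y, hy, w, hw, H⟩ := h g
  ⟨x, hW hx, y, hW hy, w, hW hw, H⟩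

/-- All triples in `W` that contain `u` and `v` have value `g`. -/
def IsMonoEdge (T : V → V → V → F) (W : Finset V) (g : F) (u v : V) : Prop :=
  u ∈ W ∧ v ∈ W ∧ u ≠ v ∧ ∀ y ∈ W, y ≠ u → y ≠ v → T u v y = g

theorem IsMonoEdge.symm {T : V → V → V → F} (hl : ∀ x y w, T y x w = T x y w)
    {W : Finset V} {g : F} {u v : V} (h : IsMonoEdge T W g u v) : IsMonoEdge T W g v u :=
  ⟨h.2.1, h.1, h.2.2.1.symm, fun y hy hyv hyu => (hl u v y).trans (h.2.2.2 y hy hyu hyv)⟩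

theorem IsMonoEdge.ne {T : V → V → V → F} (hr : ∀ x y w, T x w y = T x y w) {W : Finset V}
    (hW : 3 ≤ W.card) {g h : F} (hgh : g ≠ h) {u v u' v' : V} (hg : IsMonoEdge T W g u v)
    (hh : IsMonoEdge T W h u' v') : u ≠ u' := by
  classical
  rintro rfl
  obtain ⟨hu, hv, huv, H⟩ := hg
  obtain ⟨-, hv', huv', H'⟩ := hh
  refine hgh ?_
  by_cases hvv : v = v'
  · subst hvv
    obtain ⟨y, hy, hyn⟩ := Finset.exists_mem_notMem_of_card_lt_card
      (s := {u, v}) (t := W) (by have := Finset.card_le_two (a := u) (b := v); omega)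
    simp only [Finset.mem_insert, Finset.mem_singleton, not_or] at hyn
    rw [← H y hy hyn.1 hyn.2, H' y hy hyn.1 hyn.2]
  · rw [← H v' hv' huv'.symm (Ne.symm hvv), ← H' v hv huv.symm hvv, hr]

/-- The elements of `W` lying in all triples of value `g`. -/
noncomputable def core (T : V → V → V → F) (W : Finset V) (g : F) : Finset V :=
  open scoped Classical in
  W.filter fun v => ∀ x ∈ W, ∀ y ∈ W, ∀ w ∈ W, x ≠ y → x ≠ w → y ≠ w → T x y w = g →
    v = x ∨ v = y ∨ v = w

theorem mem_core {T : V → V → V → F} {W : Finset V} {g : F} {v : V} :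
    v ∈ core T W g ↔ v ∈ W ∧ ∀ x ∈ W, ∀ y ∈ W, ∀ w ∈ W, x ≠ y → x ≠ w → y ≠ w →
      T x y w = g → v = x ∨ v = y ∨ v = w := by
  simp [core]

theorem card_core_le_two [DecidableEq V] {T : V → V → V → F} {W : Finset V} (hW : 4 ≤ W.card)
    (hfull : RealizesAll T W)
    (hT : ∀ x ∈ W, ∀ y ∈ W, ∀ w ∈ W, ∀ t ∈ W, x ≠ y → x ≠ w → y ≠ w → t ≠ x → t ≠ y → t ≠ w →
      T x y t = T x y w ∨ T x w t = T x y w ∨ T y w t = T x y w) (g : F) :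
    (core T W g).card ≤ 2 := by
  obtain ⟨a, ha, b, hb, c, hc, hab, hac, hbc, hg⟩ := hfull g
  obtain ⟨t, ht, htn⟩ := Finset.exists_mem_notMem_of_card_lt_card
    (s := {a, b, c}) (t := W) (by have := Finset.card_le_three (a := a) (b := b) (c := c); omega)
  simp only [Finset.mem_insert, Finset.mem_singleton, not_or] at htn
  obtain ⟨hta, htb, htc⟩ : t ≠ a ∧ t ≠ b ∧ t ≠ c := htn
  have key : core T W g ⊆ {a, b} ∨ core T W g ⊆ {a, c} ∨ core T W g ⊆ {b, c} := by
    rcases hT a ha b hb c hc t ht hab hac hbc hta htb htc with h | h | h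
    · refine .inl fun v hv => ?_
      have h1 := (mem_core.1 hv).2 a ha b hb c hc hab hac hbc hg
      have h2 := (mem_core.1 hv).2 a ha b hb t ht hab hta.symm htb.symm (h.trans hg)
      grind
    · refine .inr (.inl fun v hv => ?_)
      have h1 := (mem_core.1 hv).2 a ha b hb c hc hab hac hbc hg
      have h2 := (mem_core.1 hv).2 a ha c hc t ht hac hta.symm htc.symm (h.trans hg)
      grind
    · refine .inr (.inr fun v hv => ?_)
      have h1 := (mem_core.1 hv).2 a ha b hb c hc hab hac hbc hg
      have h2 := (mem_core.1 hv).2 b hb c hc t ht hbc htb.symm htc.symm (h.trans hg)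
      grind
  rcases key with h | h | h <;> exact (Finset.card_le_card h).trans Finset.card_le_two

theorem exists_isMonoEdge [DecidableEq V] {T : V → V → V → F} (hr : ∀ x y w, T x w y = T x y w)
    (hl : ∀ x y w, T y x w = T x y w) {W : Finset V} (hfull : RealizesAll T W)
    (hT : ∀ x ∈ W, ∀ y ∈ W, ∀ w ∈ W, ∀ t ∈ W, x ≠ y → x ≠ w → y ≠ w → t ≠ x → t ≠ y → t ≠ w →
      T x y t = T x y w ∨ T x w t = T x y w ∨ T y w t = T x y w) {g : F}
    (hg : (core T W g).card = 2) :
    ∃ u v, IsMonoEdge T W g u v ∧ u ∈ core T W g ∧ v ∈ core T W g := by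
  obtain ⟨u, v, huv, hc⟩ := Finset.card_eq_two.1 hg
  have hu : u ∈ core T W g := by simp [hc]
  have hv : v ∈ core T W g := by simp [hc]
  refine ⟨u, v, ⟨(mem_core.1 hu).1, (mem_core.1 hv).1, huv, ?_⟩, hu, hv⟩
  obtain ⟨huW, hu⟩ := mem_core.1 hu
  obtain ⟨hvW, hv⟩ := mem_core.1 hv
  obtain ⟨x, hx, hxu, hxv, hxg⟩ : ∃ x ∈ W, x ≠ u ∧ x ≠ v ∧ T u v x = g := by
    obtain ⟨a, ha, b, hb, c, hc, hab, hac, hbc, habc⟩ := hfull g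
    have h1 := hu a ha b hb c hc hab hac hbc habc
    have h2 := hv a ha b hb c hc hab hac hbc habc
    rcases h1 with rfl | rfl | rfl <;> rcases h2 with rfl | rfl | rfl
    · exact absurd rfl huv
    · exact ⟨c, hc, hac.symm, hbc.symm, habc⟩
    · exact ⟨b, hb, hab.symm, hbc, by rw [hr, habc]⟩
    · exact ⟨c, hc, hbc.symm, hac.symm, by rw [hl, habc]⟩
    · exact absurd rfl huv
    · exact ⟨a, ha, hab, hac, by rw [hr, hl, habc]⟩
    · exact ⟨b, hb, hbc, hab.symm, by rw [hl, hr, habc]⟩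
    · exact ⟨a, ha, hac, hab, by rw [hl, hr, hl, habc]⟩
    · exact absurd rfl huv
  intro y hy hyu hyv
  by_cases hyx : y = x
  · rw [hyx, hxg]
  rcases hT u huW v hvW x hx y hy huv hxu.symm hxv.symm hyu hyv hyx with h | h | h
  · rw [h, hxg]
  · have := hv u huW x hx y hy hxu.symm hyu.symm (Ne.symm hyx) (h.trans hxg)
    grind
  · have := hu v hvW x hx y hy hxv.symm hyv.symm (Ne.symm hyx) (h.trans hxg)
    grind

theorem exists_card_le_six_of_core [DecidableEq V] {T : V → V → V → F}
    (hr : ∀ x y w, T x w y = T x y w) (hl : ∀ x y w, T y x w = T x y w)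
    {W : Finset V} (hW : 6 < W.card) (hfull : RealizesAll T W)
    (hT : ∀ x ∈ W, ∀ y ∈ W, ∀ w ∈ W, ∀ t ∈ W, x ≠ y → x ≠ w → y ≠ w → t ≠ x → t ≠ y → t ≠ w →
      T x y t = T x y w ∨ T x w t = T x y w ∨ T y w t = T x y w)
    (hcore : ∀ v ∈ W, ∃ g, v ∈ core T W g) :
    ∃ W' : Finset V, W'.card ≤ 6 ∧ RealizesAll T W' := by
  have hle := card_core_le_two (by omega) hfull hT
  have hsum : 6 < ∑ g : F, (core T W g).card := by
    refine hW.trans_le ((Finset.card_le_card fun v hv => ?_).trans Finset.card_biUnion_le)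
    simpa using hcore v hv
  obtain ⟨k₀, hk₀⟩ : ∃ k₀, ∀ g, g ≠ k₀ → (core T W g).card = 2 := by
    by_contra! H
    obtain ⟨g₁, -, hg₁⟩ := H 0
    obtain ⟨g₂, hg, hg₂⟩ := H g₁
    have h1 : (core T W g₁).card ≤ 1 := by have := hle g₁; omega
    have h2 : (core T W g₂).card ≤ 1 := by have := hle g₂; omega
    have hb : ∀ g, (core T W g).card ≤ if g = g₁ ∨ g = g₂ then 1 else 2 := by
      intro g
      split_ifs with hgg
      · rcases hgg with rfl | rfl <;> assumption
      · exact hle g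
    have h3 := Finset.sum_le_sum fun g (_ : g ∈ (Finset.univ : Finset F)) => hb g
    have h4 : ∀ x y : F, y ≠ x → (∑ g : F, if g = x ∨ g = y then 1 else 2) = 6 := by decide
    rw [h4 g₁ g₂ hg] at h3
    omega
  have hF : ∀ k : F, ∃ g₁ g₂ g₃ : F, g₁ ≠ k ∧ g₂ ≠ k ∧ g₃ ≠ k ∧ g₁ ≠ g₂ ∧ g₁ ≠ g₃ ∧ g₂ ≠ g₃ ∧
      ∀ x, x = k ∨ x = g₁ ∨ x = g₂ ∨ x = g₃ := by decide
  obtain ⟨g₁, g₂, g₃, hk₁, hk₂, hk₃, h₁₂, h₁₃, h₂₃, hall⟩ := hF k₀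
  obtain ⟨u₁, v₁, e₁, -, c₁⟩ := exists_isMonoEdge hr hl hfull hT (hk₀ g₁ hk₁)
  obtain ⟨u₂, v₂, e₂, -, c₂⟩ := exists_isMonoEdge hr hl hfull hT (hk₀ g₂ hk₂)
  obtain ⟨u₃, v₃, e₃, -, c₃⟩ := exists_isMonoEdge hr hl hfull hT (hk₀ g₃ hk₃)
  have hW3 : 3 ≤ W.card := by omega
  have n₁₂ := IsMonoEdge.ne hr hW3 h₁₂ e₁ e₂
  have n₁₃ := IsMonoEdge.ne hr hW3 h₁₃ e₁ e₃
  have n₂₃ := IsMonoEdge.ne hr hW3 h₂₃ e₂ e₃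
  have m₁₂ := IsMonoEdge.ne hr hW3 h₁₂ (e₁.symm hl) e₂
  have m₁₃ := IsMonoEdge.ne hr hW3 h₁₃ (e₁.symm hl) e₃
  have m₂₁ := IsMonoEdge.ne hr hW3 h₁₂.symm (e₂.symm hl) e₁
  have m₂₃ := IsMonoEdge.ne hr hW3 h₂₃ (e₂.symm hl) e₃
  have m₃₁ := IsMonoEdge.ne hr hW3 h₁₃.symm (e₃.symm hl) e₁
  have m₃₂ := IsMonoEdge.ne hr hW3 h₂₃.symm (e₃.symm hl) e₂
  refine ⟨{u₁, v₁, u₂, v₂, u₃, v₃}, Finset.card_le_six, fun g => ?_⟩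
  by_cases hg : g = k₀
  · refine ⟨u₁, by simp, u₂, by simp, u₃, by simp, n₁₂, n₁₃, n₂₃, ?_⟩
    subst hg
    rcases hall (T u₁ u₂ u₃) with h | h | h | h
    · exact h
    · have := (mem_core.1 c₁).2 u₁ e₁.1 u₂ e₂.1 u₃ e₃.1 n₁₂ n₁₃ n₂₃ h
      have := e₁.2.2.1
      grind
    · have := (mem_core.1 c₂).2 u₁ e₁.1 u₂ e₂.1 u₃ e₃.1 n₁₂ n₁₃ n₂₃ h
      have := e₂.2.2.1
      grind
    · have := (mem_core.1 c₃).2 u₁ e₁.1 u₂ e₂.1 u₃ e₃.1 n₁₂ n₁₃ n₂₃ h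
      have := e₃.2.2.1
      grind
  · rcases (hall g).resolve_left hg with rfl | rfl | rfl
    · exact ⟨u₁, by simp, v₁, by simp, u₂, by simp, e₁.2.2.1, n₁₂, m₁₂,
        e₁.2.2.2 _ e₂.1 n₁₂.symm m₁₂.symm⟩
    · exact ⟨u₂, by simp, v₂, by simp, u₁, by simp, e₂.2.2.1, n₁₂.symm, m₂₁,
        e₂.2.2.2 _ e₁.1 n₁₂ m₂₁.symm⟩
    · exact ⟨u₃, by simp, v₃, by simp, u₁, by simp, e₃.2.2.1, n₁₃.symm, m₃₁,
        e₃.2.2.2 _ e₁.1 n₁₃ m₃₁.symm⟩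

theorem F.eq_of_add_eq_zero (p q r s : F) (h : p + q + r + s = 0) (hq : q ≠ p) (hr : r ≠ p)
    (hs : s ≠ p) (g : F) : p = g ∨ q = g ∨ r = g ∨ s = g := by
  have hF : ∀ p q r : F, (q ≠ p ∧ r ≠ p ∧ p + q + r ≠ p) → ∀ g, p = g ∨ q = g ∨ r = g ∨
      p + q + r = g := by decide
  obtain rfl : p + q + r = s := by linear_combination h - F.add_self s
  exact hF p q r ⟨hq, hr, hs⟩ g

/-- A two-cocycle that takes all values in `F` already does so on at most six points. -/
theorem RealizesAll.exists_card_le_six {T : V → V → V → F} (hr : ∀ x y w, T x w y = T x y w)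
    (hl : ∀ x y w, T y x w = T x y w)
    (hT : ∀ x y w t, T x y w + T x y t + T x w t + T y w t = 0) (W : Finset V)
    (hfull : RealizesAll T W) : ∃ W' : Finset V, W'.card ≤ 6 ∧ RealizesAll T W' := by
  classical
  induction W using Finset.strongInduction with
  | H W ih =>
  by_cases hW : W.card ≤ 6
  · exact ⟨W, hW, hfull⟩
  by_cases hv : ∃ v ∈ W, RealizesAll T (W.erase v)
  · obtain ⟨v, hv, hvf⟩ := hv
    exact ih _ (Finset.erase_ssubset hv) hvf
  by_cases hrain : ∃ x y w t, RealizesAll T {x, y, w, t}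
  · obtain ⟨x, y, w, t, h⟩ := hrain
    exact ⟨_, Finset.card_le_four.trans (by norm_num), h⟩
  refine exists_card_le_six_of_core hr hl (by omega) hfull ?_ fun v hvW => ?_
  · intro x _ y _ w _ t _ hxy hxw hyw htx hty htw
    by_contra! H
    refine hrain ⟨x, y, w, t, fun g => ?_⟩
    rcases F.eq_of_add_eq_zero _ _ _ _ (hT x y w t) H.1 H.2.1 H.2.2 g with h | h | h | h
    · exact ⟨x, by simp, y, by simp, w, by simp, hxy, hxw, hyw, h⟩
    · exact ⟨x, by simp, y, by simp, t, by simp, hxy, htx.symm, hty.symm, h⟩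
    · exact ⟨x, by simp, w, by simp, t, by simp, hxw, htx.symm, htw.symm, h⟩
    · exact ⟨y, by simp, w, by simp, t, by simp, hyw, hty.symm, htw.symm, h⟩
  · by_contra! H
    refine hv ⟨v, hvW, fun g => ?_⟩
    have := H g
    rw [mem_core] at this
    push Not at this
    obtain ⟨x, hx, y, hy, w, hw, hxy, hxw, hyw, hg, hvx, hvy, hvw⟩ := this hvW
    exact ⟨x, Finset.mem_erase.2 ⟨hvx.symm, hx⟩, y, Finset.mem_erase.2 ⟨hvy.symm, hy⟩, w,
      Finset.mem_erase.2 ⟨hvw.symm, hw⟩, hxy, hxw, hyw, hg⟩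

end Reduction

theorem stmt8 (n : ℕ) (hn : 6 ≤ n) (σ : Sym2 (Fin n) → F)
    (h : ∀ g : F, ∃ a b c : Fin n, a ≠ b ∧ a ≠ c ∧ b ≠ c ∧ triSign σ a b c = g) :
    ∀ g : F, ∃ (v : Fin n) (w : (⊤ : SimpleGraph (Fin n)).Walk v v),
      w.IsHamiltonianCycle ∧ walkSign σ w = g := by
  have hτ : ∀ x y, (fun i j => σ s(i, j)) x y = (fun i j => σ s(i, j)) y x := fun x y =>
    congrArg σ Sym2.eq_swap
  obtain ⟨W', hW', hfull'⟩ := RealizesAll.exists_card_le_six (triSum_swap_right hτ)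
    (triSum_swap_left hτ) triSum_add Finset.univ fun g => by
      obtain ⟨a, b, c, hab, hac, hbc, hg⟩ := h g
      exact ⟨a, by simp, b, by simp, c, by simp, hab, hac, hbc, hg⟩
  obtain ⟨W, hWW, -, hW⟩ := Finset.exists_subsuperset_card_eq (Finset.subset_univ W') hW'
    (by simpa using hn)
  have hfull := hfull'.mono hWW
  obtain ⟨z, a, b, c, d, e, hS⟩ : ∃ z a b c d e, W.toList = [z, a, b, c, d, e] := by
    have hlen := W.length_toList
    rw [hW] at hlen
    match W.toList, hlen with
    | [z, a, b, c, d, e], _ => exact ⟨z, a, b, c, d, e, rfl⟩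
  have hnodup := W.nodup_toList
  refine Spans.exists_isHamiltonianCycle (by omega) hnodup ?_
  simp only [RealizesAll, ← Finset.mem_toList] at hfull
  rw [hS] at hnodup hfull ⊢
  exact Spans.of_triSum hτ hnodup hfull
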